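/- Let n ≥ 2 and let x = (x₁, …, xₙ) be a random vector distributed uniformly on the sphere √n·S^{n−1} of radius √n in ℝⁿ, and let Z be a standard normal random variable. Then the total variation distance between the law of the first coordinate x₁ and the law of Z satisfies d_TV(x₁, Z) ≤ 2√3/(n − 1). -/

import Mathlib

open MeasureTheory ProbabilityTheory

/-- A bounded continuous solution of the Stein equation. -/
lemma stein_solution (h : ℝ → ℝ) (hc : Continuous h) (h0 : ∀ x, 0 ≤ h x) (h1 : ∀ x, h x ≤ 1) :
    ∃ f f' : ℝ → ℝ, (∀ x, HasDerivAt f (f' x) x) ∧ Continuous f' ∧ (∀ x, |f' x| ≤ 2) ∧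
      ∀ x, f' x - x * f x = h x - ∫ t, h t ∂(gaussianReal 0 1) := by
  set m := ∫ t, h t ∂(gaussianReal 0 1) with hm
  have hint : Integrable h (gaussianReal 0 1) :=
    Integrable.of_bound hc.aestronglyMeasurable 1
      (Filter.Eventually.of_forall fun x => by rw [Real.norm_eq_abs, abs_of_nonneg (h0 x)]; exact h1 x)
  have hm0 : 0 ≤ m := integral_nonneg h0
  have hm1 : m ≤ 1 := by
    have := integral_mono (μ := gaussianReal 0 1) hint (integrable_const (1:ℝ)) h1
    simpa using this
  set g : ℝ → ℝ := fun x => h x - m with hg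
  have hgc : Continuous g := by fun_prop
  have hgb : ∀ x, |g x| ≤ 1 := fun x => by
    simp only [hg]; rw [abs_le]; constructor <;> linarith [h0 x, h1 x]
  set w : ℝ → ℝ := fun x => Real.exp (-(1/2) * x^2) with hw
  have hwc : Continuous w := by fun_prop
  have hwpos : ∀ x, 0 < w x := fun x => Real.exp_pos _
  have hwi : Integrable w := integrable_exp_neg_mul_sq (by norm_num)
  have hxwi : Integrable (fun x => x * w x) := integrable_mul_exp_neg_mul_sq (by norm_num)
  have hgwi : Integrable (fun x => g x * w x) := by
    refine hwi.mono' (by fun_prop) (Filter.Eventually.of_forall fun x => ?_)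
    rw [norm_mul, Real.norm_eq_abs, Real.norm_eq_abs, abs_of_pos (hwpos x)]
    nlinarith [hgb x, hwpos x]
  have hzero : ∫ x, g x * w x = 0 := by
    have e1 : ∫ x, g x ∂(gaussianReal 0 1) = 0 := by
      simp only [hg]
      rw [integral_sub hint (integrable_const _)]
      simp [hm]
    rw [integral_gaussianReal_eq_integral_smul (by norm_num)] at e1
    have e2 : ∀ x, gaussianPDFReal 0 1 x • g x = (√(2 * Real.pi))⁻¹ * (g x * w x) := fun x => by
      simp only [gaussianPDFReal, hw, smul_eq_mul, NNReal.coe_one, mul_one, sub_zero]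
      rw [show -x^2/2 = -(1/2)*x^2 by ring]; ring
    simp_rw [e2] at e1
    rw [integral_const_mul] at e1
    rcases mul_eq_zero.1 e1 with h | h
    · have : 0 < (√(2 * Real.pi))⁻¹ := by positivity
      linarith
    · exact h
  set G : ℝ → ℝ := fun x => ∫ t in Set.Iic x, g t * w t with hG
  have hGd : ∀ x, HasDerivAt G (g x * w x) x := fun x => by
    have e : ∀ u, G u = G 0 + ∫ t in (0:ℝ)..u, g t * w t := fun u => by
      rw [← intervalIntegral.integral_Iic_sub_Iic hgwi.integrableOn hgwi.integrableOn]
      simp [hG]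
    rw [show G = fun u => G 0 + ∫ t in (0:ℝ)..u, g t * w t from funext e]
    exact ((hgc.mul hwc).integral_hasStrictDerivAt 0 x).hasDerivAt.const_add _
  have hwd : ∀ x, HasDerivAt w (-(x * w x)) x := fun x => by
    have := (((hasDerivAt_pow 2 x).const_mul (-(1/2:ℝ)))).exp
    convert this using 1
    simp [hw]; ring
  have hnorm : ∀ t, ‖g t * w t‖ ≤ w t := fun t => by
    rw [norm_mul, Real.norm_eq_abs, Real.norm_eq_abs, abs_of_pos (hwpos t)]
    nlinarith [hgb t, hwpos t]
  have htop : Filter.Tendsto w Filter.atTop (nhds 0) := by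
    apply Real.tendsto_exp_atBot.comp
    apply Filter.Tendsto.const_mul_atTop_of_neg (by norm_num)
    exact Filter.tendsto_pow_atTop (by norm_num)
  have hbot : Filter.Tendsto w Filter.atBot (nhds 0) := by
    have : w = w ∘ Neg.neg := by ext x; simp [hw]
    rw [this]
    exact htop.comp Filter.tendsto_neg_atBot_atTop
  have hGb : ∀ x, |x * G x| ≤ w x := fun x => by
    rcases le_total 0 x with hx | hx
    · have e : G x = - ∫ t in Set.Ioi x, g t * w t := by
        have := intervalIntegral.integral_Iic_add_Ioi (b := x) hgwi.integrableOn hgwi.integrableOn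
        rw [hzero] at this
        simp only [hG]; linarith
      have e2 : ∫ t in Set.Ioi x, t * w t = w x := by
        have := integral_Ioi_of_hasDerivAt_of_tendsto' (f := fun t => - w t) (f' := fun t => t * w t)
          (a := x) (m := 0) (fun t _ => (hwd t).neg.congr_deriv (by simp)) hxwi.integrableOn
          (by simpa using htop.neg)
        simpa using this
      rw [e, mul_neg, abs_neg, ← integral_const_mul, ← e2, ← Real.norm_eq_abs]
      refine norm_integral_le_of_norm_le hxwi.integrableOn ?_
      refine (ae_restrict_iff' measurableSet_Ioi).2 (Filter.Eventually.of_forall fun t ht => ?_)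
      rw [norm_mul, Real.norm_eq_abs x, abs_of_nonneg hx]
      have ht' : x ≤ t := le_of_lt ht
      exact mul_le_mul ht' (hnorm t) (norm_nonneg _) (hx.trans ht')
    · have e2 : ∫ t in Set.Iic x, -(t * w t) = w x := by
        have := integral_Iic_of_hasDerivAt_of_tendsto' (f := w) (f' := fun t => -(t * w t))
          (a := x) (m := 0) (fun t _ => hwd t) hxwi.neg.integrableOn hbot
        simpa using this
      simp only [hG]
      rw [← integral_const_mul, ← e2, ← Real.norm_eq_abs]
      refine norm_integral_le_of_norm_le hxwi.neg.integrableOn ?_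
      refine (ae_restrict_iff' measurableSet_Iic).2 (Filter.Eventually.of_forall fun t ht => ?_)
      rw [norm_mul, Real.norm_eq_abs x, abs_of_nonpos hx, ← neg_mul]
      have ht' : t ≤ x := ht
      exact mul_le_mul (by linarith) (hnorm t) (norm_nonneg _) (by linarith)
  have hfd : ∀ x, HasDerivAt (fun x => G x / w x) (x * (G x / w x) + g x) x := fun x => by
    have := (hGd x).div (hwd x) (hwpos x).ne'
    refine this.congr_deriv ?_
    have hne := (hwpos x).ne'
    generalize w x = a at *
    field_simp
    ring
  have hfc : Continuous (fun x => G x / w x) :=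
    continuous_iff_continuousAt.2 fun x => (hfd x).continuousAt
  refine ⟨fun x => G x / w x, fun x => x * (G x / w x) + g x, hfd,
    (continuous_id.mul hfc).add hgc, fun x => ?_, fun x => by simp [hg]⟩
  have a1 : |x * (G x / w x)| ≤ 1 := by
    rw [← mul_div_assoc, abs_div, abs_of_pos (hwpos x), div_le_one (hwpos x)]
    exact hGb x
  calc _ ≤ |x * (G x / w x)| + |g x| := abs_add_le _ _
    _ ≤ 2 := by linarith [hgb x]

/-- Approximation of TV distance by continuous test functions. -/
lemma tv_of_continuous (P Q : Measure ℝ) [IsProbabilityMeasure P] [IsProbabilityMeasure Q] (C : ℝ)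
    (H : ∀ h : ℝ → ℝ, Continuous h → (∀ x, 0 ≤ h x) → (∀ x, h x ≤ 1) →
      |∫ x, h x ∂P - ∫ x, h x ∂Q| ≤ C) (s : Set ℝ) (hs : MeasurableSet s) :
    |(P s).toReal - (Q s).toReal| ≤ C := by
  refine le_of_forall_pos_le_add fun ε hε => ?_
  obtain ⟨F, hFs, hF, hFε⟩ := hs.exists_isClosed_sdiff_lt (μ := P + Q) (measure_ne_top _ _)
    (ε := ENNReal.ofReal (ε/4)) (by simpa using hε)
  obtain ⟨U, hUs, hU, -, hUε⟩ := hs.exists_isOpen_sdiff_lt (μ := P + Q) (measure_ne_top _ _)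
    (ε := ENNReal.ofReal (ε/4)) (by simpa using hε)
  obtain ⟨h, hh0, hh1, hh⟩ := exists_continuous_zero_one_of_isClosed hU.isClosed_compl hF
    (Set.disjoint_left.2 fun x hx hx' => hx (hUs (hFs hx')))
  have key : ∀ ν : Measure ℝ, IsProbabilityMeasure ν → ν ≤ P + Q →
      |∫ x, h x ∂ν - (ν s).toReal| ≤ ε/2 := by
    intro ν _ hR
    have hi : Integrable h ν := Integrable.of_bound h.continuous.aestronglyMeasurable 1
      (Filter.Eventually.of_forall fun x => by
        rw [Real.norm_eq_abs, abs_of_nonneg (hh x).1]; exact (hh x).2)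
    have e1 : ν.real (U \ s) ≤ ε/4 := by
      have := ENNReal.toReal_mono ENNReal.ofReal_ne_top (((hR (U \ s)).trans hUε.le))
      rwa [ENNReal.toReal_ofReal (by positivity)] at this
    have e2 : ν.real (s \ F) ≤ ε/4 := by
      have := ENNReal.toReal_mono ENNReal.ofReal_ne_top (((hR (s \ F)).trans hFε.le))
      rwa [ENNReal.toReal_ofReal (by positivity)] at this
    have ind : ∀ A : Set ℝ, MeasurableSet A → Integrable (A.indicator (1 : ℝ → ℝ)) ν := fun A hA =>
      (integrable_const (1:ℝ)).indicator hA
    have hA := hU.measurableSet.diff hs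
    have hB := hs.diff hF.measurableSet
    have e3 : ∫ x, h x ∂ν - (ν s).toReal = ∫ x, (h x - s.indicator 1 x) ∂ν := by
      rw [integral_sub hi (ind s hs), integral_indicator_one hs]; rfl
    rw [e3, ← Real.norm_eq_abs]
    have e4 : ∫ x, ((U \ s).indicator (1 : ℝ → ℝ) x + (s \ F).indicator (1 : ℝ → ℝ) x) ∂ν ≤ ε/2 := by
      rw [integral_add (ind _ hA) (ind _ hB), integral_indicator_one hA, integral_indicator_one hB]
      linarith
    refine le_trans (norm_integral_le_of_norm_le ((ind _ hA).add (ind _ hB))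
      (Filter.Eventually.of_forall fun x => ?_)) e4
    have a := (hh x).1
    have b := (hh x).2
    rw [Real.norm_eq_abs, abs_le]
    by_cases xs : x ∈ s
    · by_cases xF : x ∈ F
      · have := hh1 xF
        simp [xs, xF, this]
      · simp [xs, xF]; exact ⟨a, by linarith⟩
    · have xF : x ∉ F := fun hx => xs (hFs hx)
      by_cases xU : x ∈ U
      · simp [xs, xU]; exact ⟨by linarith, b⟩
      · have := hh0 xU
        simp [xs, xU, this]
  have k1 := abs_le.1 (key P inferInstance (Measure.le_add_right le_rfl))
  have k2 := abs_le.1 (key Q inferInstance (Measure.le_add_left le_rfl))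
  have k3 := abs_le.1 (H h h.continuous (fun x => (hh x).1) (fun x => (hh x).2))
  rw [abs_le]; constructor <;> linarith [k1.1, k1.2, k2.1, k2.2, k3.1, k3.2]

abbrev SphN (n : ℕ) := Metric.sphere (0 : EuclideanSpace ℝ (Fin n)) (Real.sqrt n)

lemma sphere_cont_integrable (n : ℕ) (μ : Measure (SphN n)) [IsProbabilityMeasure μ]
    (F : SphN n → ℝ) (hF : Continuous F) : Integrable F μ :=
  hF.integrable_of_hasCompactSupport (HasCompactSupport.of_compactSpace F)

lemma refl_coord (n : ℕ) (i j : Fin n) (hij : i ≠ j) (φ : ℝ) :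
    ∃ T : EuclideanSpace ℝ (Fin n) ≃ₗᵢ[ℝ] EuclideanSpace ℝ (Fin n),
      ∀ x, T x i = Real.cos (2*φ) * x i + Real.sin (2*φ) * x j ∧
        T x j = Real.sin (2*φ) * x i - Real.cos (2*φ) * x j := by
  set u : EuclideanSpace ℝ (Fin n) :=
    Real.cos φ • EuclideanSpace.single i 1 + Real.sin φ • EuclideanSpace.single j 1 with hu
  have hi : ∀ x : EuclideanSpace ℝ (Fin n), inner ℝ u x = Real.cos φ * x i + Real.sin φ * x j := by
    intro x
    simp [hu, inner_add_left, inner_smul_left, EuclideanSpace.inner_single_left]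
  have ui : u i = Real.cos φ := by simp [hu, hij]
  have uj : u j = Real.sin φ := by simp [hu, hij.symm]
  have hn : ‖u‖ ^ 2 = 1 := by
    rw [← real_inner_self_eq_norm_sq, hi, ui, uj]
    nlinarith [Real.sin_sq_add_cos_sq φ]
  refine ⟨(Submodule.span ℝ {u}).reflection, fun x => ?_⟩
  rw [Submodule.reflection_singleton_apply]
  have hn' : ((‖u‖ : ℝ) : ℝ)^2 = 1 := hn
  simp only [RCLike.ofReal_real_eq_id, id_eq, hn, hi, div_one, PiLp.sub_apply, PiLp.smul_apply, ui, uj, smul_eq_mul,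
    nsmul_eq_mul, Nat.cast_ofNat]
  rw [Real.cos_two_mul, Real.sin_two_mul]
  constructor
  · ring
  · linear_combination (2 * x j) * Real.sin_sq_add_cos_sq φ

lemma stein_pair (n : ℕ) (μ : Measure (SphN n)) [IsProbabilityMeasure μ]
    (hinv : ∀ T : EuclideanSpace ℝ (Fin n) ≃ₗᵢ[ℝ] EuclideanSpace ℝ (Fin n),
      ∀ F : SphN n → ℝ, Continuous F → ∀ hT : ∀ x : SphN n, T x ∈ Metric.sphere (0 : EuclideanSpace ℝ (Fin n)) (Real.sqrt n),
      ∫ x, F ⟨T x, hT x⟩ ∂μ = ∫ x, F x ∂μ)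
    (i j : Fin n) (hij : i ≠ j) (f f' : ℝ → ℝ) (hf : ∀ x, HasDerivAt f (f' x) x)
    (hf' : Continuous f') :
    ∫ x : SphN n, f' (x.1 i) * (x.1 j)^2 ∂μ = ∫ x : SphN n, x.1 i * f (x.1 i) ∂μ := by
  have hfc : Continuous f := continuous_iff_continuousAt.2 fun x => (hf x).continuousAt
  set F : ℝ → SphN n → ℝ := fun φ x =>
    f (Real.cos (2*φ) * x.1 i + Real.sin (2*φ) * x.1 j) *
      (Real.sin (2*φ) * x.1 i - Real.cos (2*φ) * x.1 j) with hF
  set F' : ℝ → SphN n → ℝ := fun φ x =>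
    f' (Real.cos (2*φ) * x.1 i + Real.sin (2*φ) * x.1 j) *
      (2 * (-Real.sin (2*φ) * x.1 i + Real.cos (2*φ) * x.1 j)) *
      (Real.sin (2*φ) * x.1 i - Real.cos (2*φ) * x.1 j)
    + f (Real.cos (2*φ) * x.1 i + Real.sin (2*φ) * x.1 j) *
      (2 * (Real.cos (2*φ) * x.1 i + Real.sin (2*φ) * x.1 j)) with hF'
  have hconst : ∀ φ, ∫ x, F φ x ∂μ = ∫ x : SphN n, f (x.1 i) * x.1 j ∂μ := by
    intro φ
    obtain ⟨T, hT⟩ := refl_coord n i j hij φ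
    have := hinv T (fun x => f (x.1 i) * x.1 j) (by fun_prop)
      (fun x => by
        have := x.2
        simp only [Metric.mem_sphere, dist_zero_right] at this ⊢
        rw [T.norm_map]; exact this)
    rw [← this]
    simp only [hF, (hT _).1, (hT _).2]
  have hFc : ∀ φ, Continuous (F φ) := fun φ => by simp only [hF]; fun_prop
  have hF'c : Continuous (Function.uncurry F') := by
    simp only [hF', Function.uncurry_def]; fun_prop
  obtain ⟨C, hC⟩ := (isCompact_Icc (a := (-1:ℝ)) (b := 1)).prod (isCompact_univ (X := SphN n))
    |>.exists_bound_of_continuousOn hF'c.continuousOn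
  have hd := hasDerivAt_integral_of_dominated_loc_of_deriv_le (μ := μ) (F := F) (F' := F') (x₀ := (0:ℝ))
    (s := Set.Icc (-1) 1) (bound := fun _ => C) (Icc_mem_nhds (by norm_num) (by norm_num))
    (Filter.Eventually.of_forall fun φ => (hFc φ).aestronglyMeasurable)
    (sphere_cont_integrable n μ _ (hFc 0))
    (hF'c.comp (by fun_prop : Continuous fun x : SphN n => ((0:ℝ), x))).aestronglyMeasurable
    (Filter.Eventually.of_forall fun x φ hφ => hC (φ, x) ⟨hφ, trivial⟩)
    (integrable_const C)
    (Filter.Eventually.of_forall fun x φ _ => by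
      have d2 : HasDerivAt (fun φ : ℝ => 2 * φ) 2 φ := by simpa using (hasDerivAt_id φ).const_mul 2
      have dc := d2.cos
      have ds := d2.sin
      have da := (dc.mul_const (x.1 i)).add (ds.mul_const (x.1 j))
      have db := (ds.mul_const (x.1 i)).sub (dc.mul_const (x.1 j))
      have := ((hf _).comp φ da).mul db
      refine this.congr_deriv ?_
      simp [hF']
      ring)
  have h0 : ∫ x, F' 0 x ∂μ = 0 := by
    have h1 := hd.2
    simp_rw [hconst] at h1
    exact h1.unique (hasDerivAt_const _ _)
  have e : ∀ x : SphN n, F' 0 x = 2 * (x.1 i * f (x.1 i)) - 2 * (f' (x.1 i) * (x.1 j)^2) := fun x => by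
    simp [hF']; ring
  simp_rw [e] at h0
  rw [integral_sub (sphere_cont_integrable n μ _ (by fun_prop)) (sphere_cont_integrable n μ _ (by fun_prop)),
    integral_const_mul, integral_const_mul] at h0
  linarith

lemma stein_sphere (n : ℕ) (μ : Measure (SphN n)) [IsProbabilityMeasure μ]
    (hinv : ∀ T : EuclideanSpace ℝ (Fin n) ≃ₗᵢ[ℝ] EuclideanSpace ℝ (Fin n),
      ∀ F : SphN n → ℝ, Continuous F → ∀ hT : ∀ x : SphN n, T x ∈ Metric.sphere (0 : EuclideanSpace ℝ (Fin n)) (Real.sqrt n),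
      ∫ x, F ⟨T x, hT x⟩ ∂μ = ∫ x, F x ∂μ)
    (i : Fin n) (f f' : ℝ → ℝ) (hf : ∀ x, HasDerivAt f (f' x) x)
    (hf' : Continuous f') :
    ∫ x : SphN n, f' (x.1 i) * (n - (x.1 i)^2) ∂μ = (n - 1) * ∫ x : SphN n, x.1 i * f (x.1 i) ∂μ := by
  have e : ∀ x : SphN n, f' (x.1 i) * (n - (x.1 i)^2) =
      ∑ j ∈ Finset.univ.erase i, f' (x.1 i) * (x.1 j)^2 := fun x => by
    rw [← Finset.mul_sum, Finset.sum_erase_eq_sub (Finset.mem_univ i)]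
    have h1 := EuclideanSpace.real_norm_sq_eq x.1
    have h2 := x.2
    simp only [Metric.mem_sphere, dist_zero_right] at h2
    rw [h2, Real.sq_sqrt (Nat.cast_nonneg n)] at h1
    rw [← h1]
  simp_rw [e]
  rw [integral_finsetSum _ (fun j _ => sphere_cont_integrable n μ _ (by fun_prop)),
    Finset.sum_congr rfl (fun j hj => stein_pair n μ hinv i j (Finset.ne_of_mem_erase hj).symm f f' hf hf')]
  rw [Finset.sum_const, Finset.card_erase_of_mem (Finset.mem_univ i), Finset.card_univ, Fintype.card_fin, nsmul_eq_mul,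
    Nat.cast_sub (by have := i.2; omega), Nat.cast_one]

theorem tv_bound_sphere_first_coordinate (n : ℕ) (hn : 2 ≤ n)
    (μ : Measure (Metric.sphere (0 : EuclideanSpace ℝ (Fin n)) (Real.sqrt n)))
    [IsProbabilityMeasure μ]
    (hinv : ∀ T : EuclideanSpace ℝ (Fin n) ≃ₗᵢ[ℝ] EuclideanSpace ℝ (Fin n),
      μ.map (fun x : Metric.sphere (0 : EuclideanSpace ℝ (Fin n)) (Real.sqrt n) =>
        (⟨T x, by
          have hx := x.2
          simp only [Metric.mem_sphere, dist_zero_right] at hx ⊢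
          rw [T.norm_map]
          exact hx⟩ :
          Metric.sphere (0 : EuclideanSpace ℝ (Fin n)) (Real.sqrt n))) = μ) :
    ∀ s : Set ℝ, MeasurableSet s →
      |((μ.map (fun x : Metric.sphere (0 : EuclideanSpace ℝ (Fin n)) (Real.sqrt n) =>
            (x : EuclideanSpace ℝ (Fin n)) (⟨0, by omega⟩ : Fin n))) s).toReal
          - ((gaussianReal 0 1) s).toReal|
        ≤ 2 * Real.sqrt 3 / ((n : ℝ) - 1) := by
  have hinv' : ∀ T : EuclideanSpace ℝ (Fin n) ≃ₗᵢ[ℝ] EuclideanSpace ℝ (Fin n),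
      ∀ F : SphN n → ℝ, Continuous F → ∀ hT : ∀ x : SphN n, T x ∈ Metric.sphere (0 : EuclideanSpace ℝ (Fin n)) (Real.sqrt n),
      ∫ x, F ⟨T x, hT x⟩ ∂μ = ∫ x, F x ∂μ := by
    intro T F hF hT
    have hc : Continuous (fun x : SphN n => (⟨T x, hT x⟩ : SphN n)) :=
      (T.continuous.comp continuous_subtype_val).subtype_mk _
    conv_rhs => rw [← hinv T]
    exact (integral_map hc.measurable.aemeasurable hF.aestronglyMeasurable).symm
  set i : Fin n := ⟨0, by omega⟩ with hi
  have hn1 : (0:ℝ) < n - 1 := by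
    have : (2:ℝ) ≤ n := by exact_mod_cast hn
    linarith
  have hmeas : Measurable (fun x : SphN n => x.1 i) := by
    have : Continuous (fun x : SphN n => x.1 i) := by fun_prop
    exact this.measurable
  have := Measure.isProbabilityMeasure_map (μ := μ) hmeas.aemeasurable
  have int : ∀ F : ℝ → ℝ, Continuous F → Integrable (fun x : SphN n => F (x.1 i)) μ := fun F hF =>
    sphere_cont_integrable n μ _ (by fun_prop)
  have m2 : ∫ x : SphN n, (x.1 i)^2 ∂μ = 1 := by
    have := stein_sphere n μ hinv' i (fun x => x) (fun _ => 1) hasDerivAt_id continuous_const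
    simp only [one_mul] at this
    rw [integral_sub (integrable_const _) (int (fun y => y^2) (by fun_prop))] at this
    simp only [← sq, integral_const, probReal_univ, one_smul] at this
    have h : (n:ℝ) * (∫ x : SphN n, (x.1 i)^2 ∂μ) = n * 1 := by linarith
    exact mul_left_cancel₀ (by linarith) h
  have m4 : ∫ x : SphN n, (x.1 i)^4 ∂μ ≤ 3 := by
    have := stein_sphere n μ hinv' i (fun x => x^3) (fun x => 3*x^2)
      (fun x => by simpa using hasDerivAt_pow 3 x) (by fun_prop)
    have e : ∀ x : SphN n, 3 * (x.1 i)^2 * (n - (x.1 i)^2) = 3 * n * (x.1 i)^2 - 3 * (x.1 i)^4 := fun x => by ring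
    have e' : ∀ x : SphN n, x.1 i * (x.1 i)^3 = (x.1 i)^4 := fun x => by ring
    simp_rw [e, e'] at this
    rw [integral_sub (int (fun y => 3 * n * y^2) (by fun_prop)) (int (fun y => 3 * y^4) (by fun_prop)),
      integral_const_mul, integral_const_mul, m2] at this
    have h : ((n:ℝ) + 2) * (∫ x : SphN n, (x.1 i)^4 ∂μ) = 3 * n := by linarith
    nlinarith
  have m1 : ∫ x : SphN n, |(x.1 i)^2 - 1| ∂μ ≤ √3 := by
    have s3 : 0 < √3 := by positivity
    have s3' : √3 * √3 = 3 := Real.mul_self_sqrt (by norm_num)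
    have hle : ∀ x : SphN n, √3 * 2 * |(x.1 i)^2 - 1| ≤ (x.1 i)^4 - 2 * (x.1 i)^2 + 4 := fun x => by
      nlinarith [sq_nonneg (|(x.1 i)^2 - 1| - √3), sq_abs ((x.1 i)^2 - 1)]
    have := integral_mono (μ := μ) (int (fun y => √3 * 2 * |y^2 - 1|) (by fun_prop))
      (int (fun y => y^4 - 2*y^2+4) (by fun_prop)) hle
    rw [integral_const_mul, integral_add (int (fun y => y^4 - 2*y^2) (by fun_prop)) (integrable_const _),
      integral_sub (int (fun y => y^4) (by fun_prop)) (int (fun y => 2*y^2) (by fun_prop)), integral_const_mul, m2] at this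
    simp only [integral_const, probReal_univ, one_smul] at this
    nlinarith
  refine tv_of_continuous _ _ _ fun h hc h0 h1 => ?_
  obtain ⟨f, f', hf, hf', hb, hs⟩ := stein_solution h hc h0 h1
  have hfc : Continuous f := continuous_iff_continuousAt.2 fun x => (hf x).continuousAt
  rw [integral_map hmeas.aemeasurable hc.aestronglyMeasurable]
  have e1 : ∫ x : SphN n, h (x.1 i) ∂μ - ∫ x, h x ∂(gaussianReal 0 1) =
      ∫ x : SphN n, f' (x.1 i) ∂μ - ∫ x : SphN n, x.1 i * f (x.1 i) ∂μ := by
    rw [← integral_sub (int f' hf') (int (fun y => y * f y) (by fun_prop))]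
    simp_rw [hs]
    rw [integral_sub (int h hc) (integrable_const _)]
    simp
  have e2 := stein_sphere n μ hinv' i f f' hf hf'
  have e3 : ∀ x : SphN n, f' (x.1 i) * (n - (x.1 i)^2) = (n - 1) * f' (x.1 i) - f' (x.1 i) * ((x.1 i)^2 - 1) :=
    fun x => by ring
  simp_rw [e3] at e2
  rw [integral_sub (int (fun y => (n-1) * f' y) (by fun_prop)) (int (fun y => f' y * (y^2-1)) (by fun_prop)),
    integral_const_mul] at e2
  have e4 : |∫ x : SphN n, f' (x.1 i) * ((x.1 i)^2 - 1) ∂μ| ≤ 2 * √3 := by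
    rw [← Real.norm_eq_abs]
    refine (norm_integral_le_of_norm_le (int (fun y => 2 * |y^2-1|) (by fun_prop))
      (Filter.Eventually.of_forall fun x => ?_)).trans ?_
    · rw [norm_mul, Real.norm_eq_abs, Real.norm_eq_abs]
      exact mul_le_mul_of_nonneg_right (hb _) (abs_nonneg _)
    · rw [integral_const_mul]; linarith
  have e5 : ∫ x : SphN n, h (x.1 i) ∂μ - ∫ x, h x ∂(gaussianReal 0 1) =
      (∫ x : SphN n, f' (x.1 i) * ((x.1 i)^2 - 1) ∂μ) / (n - 1) := by
    rw [e1, eq_div_iff hn1.ne']; linarith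
  rw [e5, abs_div, abs_of_pos hn1]
  gcongr
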